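/- Fix cog ∈ C with cog > cog*, so A(cog) = {S, R, N, H}. Let V : ℤ × C → ℝ satisfy the value-bound property with constants t_s, t_max, ρ. Assume the sojourn-time ordering t_s < E[τ|cog,R] < E[τ|cog,N] < E[τ|cog,H] and the condition min{ E[τ|cog,H] − E[τ|cog,N], E[τ|cog,N] − E[τ|cog,R], E[τ|cog,R] − t_s } + t_s·γ^{E[τ|cog,H]}/(1 − γ^{t_max}) ≥ (t_max/(1−ρ))·max_{a ∈ A(cog)} E[γ^τ|cog,a]. Then there exist thresholds q₁*(cog) ≤ q₂*(cog) ≤ q₃*(cog) in ℤ ∪ {−∞, +∞} and a selection π(q) ∈ argmax_{a ∈ A(cog)} Q_V(q,cog,a) for each q ∈ ℤ such that π(q) = H for q ≤ q₁*(cog), π(q) = N for q₁*(cog) < q ≤ q₂*(cog), π(q) = R for q₂*(cog) < q ≤ q₃*(cog), and π(q) = S for q > q₃*(cog). -/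

import Mathlib

open scoped BigOperators

namespace Fidelity

/-- The actions available to the human operator: skip, rest, normal fidelity, high fidelity. -/
inductive Action : Type
  | S | R | N | H
deriving DecidableEq

/-- Admissible action set: `{S, N, H}` for `cog ≤ cog*` and `{S, R, N, H}` for `cog > cog*`. -/
def Act {C : Type*} [LinearOrder C] (cogStar cog : C) : Finset Action :=
  if cog ≤ cogStar then {Action.S, Action.N, Action.H}
  else {Action.S, Action.R, Action.N, Action.H}

lemma Act_nonempty {C : Type*} [LinearOrder C] (cogStar cog : C) :
    (Act cogStar cog).Nonempty := by
  unfold Act; split <;> exact ⟨Action.S, by simp⟩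

/-- The reward `r(a)`: `r(H) = r_H`, `r(N) = r_N`, `r(S) = r(R) = 0`. -/
noncomputable def rew (rH rN : ℝ) : Action → ℝ
  | Action.H => rH
  | Action.N => rN
  | _ => 0

/-- Expected net immediate reward
`R((q,cog),a) = r(a) − c·E[τ|cog,a]·q − (cλ/2)·E[τ²|cog,a]`. -/
noncomputable def Rimm {C : Type*} (c lam rH rN : ℝ) (Etau Etau2 : C → Action → ℝ)
    (q : ℤ) (cog : C) (a : Action) : ℝ :=
  rew rH rN a - c * Etau cog a * (q : ℝ) - c * lam / 2 * Etau2 cog a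

/-- The Poisson probability of `w` arrivals when the mean number of arrivals is `μ`. -/
noncomputable def poissonPMF (μ : ℝ) (w : ℕ) : ℝ :=
  Real.exp (-μ) * μ ^ w / (w.factorial : ℝ)

/-- The next queue length: `q − 1 + w` under actions `S, N, H` and `q + w` under `R`. -/
def nextQ (a : Action) (q : ℤ) (w : ℕ) : ℤ :=
  if a = Action.R then q + (w : ℤ) else q - 1 + (w : ℤ)

/-- `E[γ^τ | cog, a]`, the expected discount over a sojourn in state `cog` under action `a`. -/
noncomputable def Egamma {C : Type*} [Fintype C] (γ : ℝ) (P : C → Action → ℕ → C → ℝ)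
    (cog : C) (a : Action) : ℝ :=
  ∑' (τ : ℕ), ∑' (cog' : C), γ ^ τ * P cog a τ cog'

/-- The Q-value of action `a` at `(q, cog)` for the continuation value function `V`:
`Q_V(q,cog,a) = R((q,cog),a) + Σ_{τ,cog',w} γ^τ·P(τ,cog'|cog,a)·Poisson(λτ)(w)·V(q',cog')`. -/
noncomputable def Qval {C : Type*} [Fintype C] (c lam rH rN γ : ℝ)
    (Etau Etau2 : C → Action → ℝ) (P : C → Action → ℕ → C → ℝ)
    (V : ℤ → C → ℝ) (q : ℤ) (cog : C) (a : Action) : ℝ :=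
  Rimm c lam rH rN Etau Etau2 q cog a +
    ∑' (τ : ℕ), ∑' (cog' : C), ∑' (w : ℕ),
      γ ^ τ * P cog a τ cog' * poissonPMF (lam * (τ : ℝ)) w * V (nextQ a q w) cog'

/-- `V` satisfies the value-bound property with constants `t_s`, `t_max`, `ρ`:
for all `cog'`, `q` and `Δ ∈ ℕ`,
`c·t_s·Δ/(1 − γ^{t_max}) ≤ V(q,cog') − V(q+Δ,cog') ≤ c·t_max·Δ/(1 − ρ)`. -/
def ValueBound {C : Type*} (c γ ρ : ℝ) (ts tmax : ℕ) (V : ℤ → C → ℝ) : Prop :=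
  ∀ (cog' : C) (q : ℤ) (Δ : ℕ),
    c * (ts : ℝ) * (Δ : ℝ) / (1 - γ ^ tmax) ≤ V q cog' - V (q + (Δ : ℤ)) cog' ∧
    V q cog' - V (q + (Δ : ℤ)) cog' ≤ c * (tmax : ℝ) * (Δ : ℝ) / (1 - ρ)

/-- The Poisson average of the values of `v` over the states reached from `n`. -/
noncomputable def poissonMean (μ : ℝ) (v : ℤ → ℝ) (n : ℤ) : ℝ :=
  ∑' w : ℕ, poissonPMF μ w * v (n + w)

lemma poissonPMF_nonneg {μ : ℝ} (hμ : 0 ≤ μ) (w : ℕ) : 0 ≤ poissonPMF μ w := by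
  unfold poissonPMF; positivity

lemma hasSum_poissonPMF (μ : ℝ) : HasSum (poissonPMF μ) 1 := by
  have h := (NormedSpace.expSeries_div_hasSum_exp (𝔸 := ℝ) μ).mul_left (Real.exp (-μ))
  rw [← Real.exp_eq_exp_ℝ, ← Real.exp_add, neg_add_cancel, Real.exp_zero] at h
  exact h.congr_fun (fun w => by unfold poissonPMF; ring)

lemma hasSum_poissonPMF_mul_id (μ : ℝ) :
    HasSum (fun w : ℕ => poissonPMF μ w * (w : ℝ)) μ := by
  rw [← hasSum_nat_add_iff' 1]
  have h := (hasSum_poissonPMF μ).mul_left μ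
  simp only [mul_one] at h
  simp only [Finset.range_one, Finset.sum_singleton, Nat.cast_zero, mul_zero, sub_zero]
  refine h.congr_fun fun w => ?_
  unfold poissonPMF
  rw [Nat.factorial_succ]
  push_cast
  field_simp
  ring

section Continuation

variable {v : ℤ → ℝ} {L U : ℝ}

/-- `v` decreases by at least `L` and at most `U` per unit step. -/
def SlopeBound (L U : ℝ) (v : ℤ → ℝ) : Prop :=
  ∀ (n : ℤ) (k : ℕ), L * k ≤ v n - v (n + k) ∧ v n - v (n + k) ≤ U * k

lemma SlopeBound.abs_shift_le (hL : 0 ≤ L) (hv : SlopeBound L U v) (n : ℤ) (w : ℕ) :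
    |v (n + w)| ≤ |v n| + U * w := by
  have h := hv n w
  have hw : 0 ≤ L * (w : ℝ) := by positivity
  rw [abs_le]
  constructor
  · linarith [neg_abs_le (v n)]
  · linarith [le_abs_self (v n)]

lemma hasSum_poissonPMF_mul_affine (μ a b : ℝ) :
    HasSum (fun w : ℕ => poissonPMF μ w * (a + b * w)) (a + b * μ) := by
  have h := ((hasSum_poissonPMF μ).mul_left a).add ((hasSum_poissonPMF_mul_id μ).mul_left b)
  rw [mul_one] at h
  exact h.congr_fun fun w => by ring

lemma SlopeBound.norm_poisson_le (hL : 0 ≤ L) (hv : SlopeBound L U v) {μ : ℝ} (hμ : 0 ≤ μ)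
    (n : ℤ) (w : ℕ) :
    ‖poissonPMF μ w * v (n + w)‖ ≤ poissonPMF μ w * (|v n| + U * w) := by
  rw [norm_mul, Real.norm_eq_abs, Real.norm_eq_abs, abs_of_nonneg (poissonPMF_nonneg hμ w)]
  exact mul_le_mul_of_nonneg_left (hv.abs_shift_le hL n w) (poissonPMF_nonneg hμ w)

lemma SlopeBound.summable_poisson (hL : 0 ≤ L) (hv : SlopeBound L U v) {μ : ℝ} (hμ : 0 ≤ μ)
    (n : ℤ) : Summable fun w : ℕ => poissonPMF μ w * v (n + w) :=
  (hasSum_poissonPMF_mul_affine μ _ _).summable.of_norm_bounded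
    (hv.norm_poisson_le hL hμ n)

lemma SlopeBound.abs_poissonMean_le (hL : 0 ≤ L) (hv : SlopeBound L U v) {μ : ℝ} (hμ : 0 ≤ μ)
    (n : ℤ) : |poissonMean μ v n| ≤ |v n| + U * μ :=
  tsum_of_norm_bounded (hasSum_poissonPMF_mul_affine μ _ _) (hv.norm_poisson_le hL hμ n)

lemma SlopeBound.poissonMean_sub_mem (hL : 0 ≤ L) (hv : SlopeBound L U v) {μ : ℝ}
    (hμ : 0 ≤ μ) (n : ℤ) :
    poissonMean μ v n - poissonMean μ v (n + 1) ∈ Set.Icc L U := by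
  have hd := (hv.summable_poisson hL hμ n).hasSum.sub (hv.summable_poisson hL hμ (n + 1)).hasSum
  have hc (b : ℝ) : HasSum (fun w : ℕ => poissonPMF μ w * b) b := by
    simpa using (hasSum_poissonPMF μ).mul_right b
  have hstep (w : ℕ) : L ≤ v (n + w) - v (n + 1 + w) ∧ v (n + w) - v (n + 1 + w) ≤ U := by
    have h := hv (n + w) 1
    simpa [add_right_comm] using h
  constructor
  · refine hasSum_le (fun w => ?_) (hc L) hd
    rw [← mul_sub]
    exact mul_le_mul_of_nonneg_left (hstep w).1 (poissonPMF_nonneg hμ w)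
  · refine hasSum_le (fun w => ?_) hd (hc U)
    rw [← mul_sub]
    exact mul_le_mul_of_nonneg_left (hstep w).2 (poissonPMF_nonneg hμ w)

end Continuation

section Sojourn

variable {C : Type*} [Fintype C] {p : ℕ → C → ℝ} {γ : ℝ}

/-- The expected discounted continuation value when the queue shifts from `n` by the arrivals. -/
noncomputable def contValue (γ lam : ℝ) (p : ℕ → C → ℝ) (V : ℤ → C → ℝ) (n : ℤ) : ℝ :=
  ∑' τ : ℕ, ∑ x : C, γ ^ τ * p τ x * poissonMean (lam * τ) (fun m => V m x) n

lemma summable_discount (hγ : γ ∈ Set.Ioo (0 : ℝ) 1) (hp : ∀ τ x, 0 ≤ p τ x)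
    (hs : Summable fun τ => ∑ x, p τ x) : Summable fun τ => ∑ x, γ ^ τ * p τ x := by
  refine hs.of_nonneg_of_le
    (fun τ => Finset.sum_nonneg fun x _ => mul_nonneg (pow_nonneg hγ.1.le τ) (hp τ x))
    (fun τ => Finset.sum_le_sum fun x _ => ?_)
  exact mul_le_of_le_one_left (hp τ x) (pow_le_one₀ hγ.1.le hγ.2.le)

/-- Jensen's inequality for `x ↦ γ ^ x` under the sojourn-time law. -/
lemma rpow_mean_le_discount (hγ : γ ∈ Set.Ioo (0 : ℝ) 1) (hp : ∀ τ x, 0 ≤ p τ x) {m : ℝ}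
    (h₁ : HasSum (fun τ => ∑ x, p τ x) 1) (hm : HasSum (fun τ : ℕ => ∑ x, (τ : ℝ) * p τ x) m) :
    γ ^ m ≤ ∑' τ : ℕ, ∑ x, γ ^ τ * p τ x := by
  have htan (τ : ℕ) : γ ^ m * (1 - Real.log γ * m) + γ ^ m * Real.log γ * τ ≤ γ ^ τ := by
    have hexp : γ ^ τ = γ ^ m * Real.exp (Real.log γ * (τ - m)) := by
      rw [← Real.rpow_natCast, Real.rpow_def_of_pos hγ.1, Real.rpow_def_of_pos hγ.1,
        ← Real.exp_add]
      ring_nf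
    rw [hexp]
    have h := mul_le_mul_of_nonneg_left (Real.add_one_le_exp (Real.log γ * (τ - m)))
      (Real.rpow_nonneg hγ.1.le m)
    linarith
  have hlin := (h₁.mul_left (γ ^ m * (1 - Real.log γ * m))).add
    (hm.mul_left (γ ^ m * Real.log γ))
  have hle := hasSum_le (fun τ => ?_) hlin (summable_discount hγ hp h₁.summable).hasSum
  · linarith
  · rw [Finset.mul_sum, Finset.mul_sum, ← Finset.sum_add_distrib]
    refine Finset.sum_le_sum fun x _ => ?_
    have h := mul_le_mul_of_nonneg_right (htan τ) (hp τ x)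
    linarith

variable {lam L U : ℝ} {V : ℤ → C → ℝ}

lemma summable_contValue (hγ : γ ∈ Set.Ioo (0 : ℝ) 1) (hlam : 0 ≤ lam) (hL : 0 ≤ L)
    (hp : ∀ τ x, 0 ≤ p τ x) (h₁ : Summable fun τ => ∑ x, p τ x)
    (hm : Summable fun τ : ℕ => ∑ x, (τ : ℝ) * p τ x)
    (hV : ∀ x, SlopeBound L U fun m => V m x) (n : ℤ) :
    Summable fun τ : ℕ => ∑ x, γ ^ τ * p τ x * poissonMean (lam * τ) (fun m => V m x) n := by
  refine Summable.of_norm_bounded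
    (g := fun τ : ℕ => (∑ y, |V n y|) * (∑ x, p τ x) + U * lam * ∑ x, (τ : ℝ) * p τ x)
    ((h₁.mul_left _).add (hm.mul_left _)) fun τ => ?_
  refine (norm_sum_le _ _).trans ?_
  rw [Finset.mul_sum _ _ (∑ y, |V n y|), Finset.mul_sum, ← Finset.sum_add_distrib]
  refine Finset.sum_le_sum fun x _ => ?_
  have hpoisson := (hV x).abs_poissonMean_le hL (mul_nonneg hlam τ.cast_nonneg) n
  have hsingle : |V n x| ≤ ∑ y, |V n y| :=
    Finset.single_le_sum (f := fun y => |V n y|) (fun y _ => abs_nonneg _) (Finset.mem_univ x)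
  rw [norm_mul, Real.norm_eq_abs, Real.norm_eq_abs,
    abs_of_nonneg (mul_nonneg (pow_nonneg hγ.1.le τ) (hp τ x))]
  calc γ ^ τ * p τ x * |poissonMean (lam * τ) (fun m => V m x) n|
      ≤ p τ x * ((∑ y, |V n y|) + U * (lam * τ)) :=
        mul_le_mul (mul_le_of_le_one_left (hp τ x) (pow_le_one₀ hγ.1.le hγ.2.le))
          (by linarith) (abs_nonneg _) (hp τ x)
    _ = _ := by ring

lemma contValue_sub_mem (hγ : γ ∈ Set.Ioo (0 : ℝ) 1) (hlam : 0 ≤ lam) (hL : 0 ≤ L)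
    (hp : ∀ τ x, 0 ≤ p τ x) (h₁ : Summable fun τ => ∑ x, p τ x)
    (hm : Summable fun τ : ℕ => ∑ x, (τ : ℝ) * p τ x)
    (hV : ∀ x, SlopeBound L U fun m => V m x) (n : ℤ) :
    contValue γ lam p V n - contValue γ lam p V (n + 1) ∈
      Set.Icc (L * ∑' τ : ℕ, ∑ x, γ ^ τ * p τ x) (U * ∑' τ : ℕ, ∑ x, γ ^ τ * p τ x) := by
  have hd := (summable_contValue hγ hlam hL hp h₁ hm hV n).hasSum.sub
    (summable_contValue hγ hlam hL hp h₁ hm hV (n + 1)).hasSum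
  have hg := (summable_discount hγ hp h₁).hasSum
  have hw (τ : ℕ) (x : C) : 0 ≤ γ ^ τ * p τ x := mul_nonneg (pow_nonneg hγ.1.le τ) (hp τ x)
  have hmem (τ : ℕ) (x : C) := (hV x).poissonMean_sub_mem hL (mul_nonneg hlam τ.cast_nonneg) n
  constructor
  · refine hasSum_le (fun τ => ?_) (hg.mul_left L) hd
    rw [Finset.mul_sum, ← Finset.sum_sub_distrib]
    refine Finset.sum_le_sum fun x _ => ?_
    rw [← mul_sub, mul_comm L]
    exact mul_le_mul_of_nonneg_left (hmem τ x).1 (hw τ x)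
  · refine hasSum_le (fun τ => ?_) hd (hg.mul_left U)
    rw [Finset.mul_sum, ← Finset.sum_sub_distrib]
    refine Finset.sum_le_sum fun x _ => ?_
    rw [← mul_sub, mul_comm U]
    exact mul_le_mul_of_nonneg_left (hmem τ x).2 (hw τ x)

lemma Qval_eq (c lam rH rN γ : ℝ) (Etau Etau2 : C → Action → ℝ) (P : C → Action → ℕ → C → ℝ)
    (V : ℤ → C → ℝ) (q : ℤ) (cog : C) (a : Action) :
    Qval c lam rH rN γ Etau Etau2 P V q cog a =
      Rimm c lam rH rN Etau Etau2 q cog a + contValue γ lam (P cog a) V (nextQ a q 0) := by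
  have hn (w : ℕ) : nextQ a q w = nextQ a q 0 + w := by unfold nextQ; split <;> simp
  unfold Qval contValue poissonMean
  congr 1
  refine tsum_congr fun τ => ?_
  rw [tsum_fintype]
  refine Finset.sum_congr rfl fun x _ => ?_
  rw [← tsum_mul_left]
  refine tsum_congr fun w => ?_
  rw [hn w, mul_assoc]

end Sojourn

/-- The threshold of a monotone labelling of the integers at level `i`. -/
noncomputable def threshold (f : ℤ → ℕ) (i : ℕ) : EReal :=
  sSup ((fun q : ℤ => ((q : ℝ) : EReal)) '' {q | f q ≤ i})

lemma threshold_mono (f : ℤ → ℕ) {i j : ℕ} (h : i ≤ j) : threshold f i ≤ threshold f j :=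
  sSup_le_sSup (Set.image_mono fun _ hq => le_trans hq h)

lemma le_threshold_iff {f : ℤ → ℕ} (hf : Monotone f) (i : ℕ) (q : ℤ) :
    ((q : ℝ) : EReal) ≤ threshold f i ↔ f q ≤ i := by
  refine ⟨fun h => ?_, fun h => le_sSup ⟨q, h, rfl⟩⟩
  by_contra! hlt
  have hsup : threshold f i ≤ (((q - 1 : ℤ) : ℝ) : EReal) := by
    refine sSup_le ?_
    rintro _ ⟨m, hm, rfl⟩
    have hmq : m < q := by
      by_contra! hqm
      exact absurd (hf hqm) (by have : f m ≤ i := hm; omega)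
    have : (m : ℝ) ≤ ((q - 1 : ℤ) : ℝ) := by exact_mod_cast Int.le_sub_one_of_lt hmq
    exact EReal.coe_le_coe_iff.2 this
  have h' : (q : ℝ) ≤ ((q - 1 : ℤ) : ℝ) := by exact_mod_cast h.trans hsup
  push_cast at h'
  linarith

/-- The position of an action in the order in which it is selected as the queue grows. -/
def Action.rank : Action → ℕ
  | .H => 0
  | .N => 1
  | .R => 2
  | .S => 3

lemma Action.rank_injective : Function.Injective Action.rank := by
  intro a b h
  cases a <;> cases b <;> simp_all [Action.rank]

/-- If switching to a higher-ranked action becomes ever more attractive as the queue grows,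
some optimal selection has monotone rank. -/
lemma exists_monotone_argmax (s : Finset Action) (hs : s.Nonempty) (Q : ℤ → Action → ℝ)
    (hQ : ∀ a ∈ s, ∀ b ∈ s, a.rank ≤ b.rank → Antitone fun q => Q q a - Q q b) :
    ∃ π : ℤ → Action, (∀ q, π q ∈ s ∧ ∀ a ∈ s, Q q a ≤ Q q (π q)) ∧
      Monotone fun q => (π q).rank := by
  have hex (q : ℤ) : ∃ a ∈ s, (∀ b ∈ s, Q q b ≤ Q q a) ∧
      ∀ b ∈ s, Q q a ≤ Q q b → b.rank ≤ a.rank := by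
    obtain ⟨m, hm, hmax⟩ := s.exists_max_image (Q q) hs
    obtain ⟨a, ha, hamax⟩ := (s.filter fun b => Q q m ≤ Q q b).exists_max_image Action.rank
      ⟨m, by simp [hm]⟩
    rw [Finset.mem_filter] at ha
    exact ⟨a, ha.1, fun b hb => (hmax b hb).trans ha.2,
      fun b hb hab => hamax b (Finset.mem_filter.2 ⟨hb, ha.2.trans hab⟩)⟩
  choose π hmem hopt htop using hex
  refine ⟨π, fun q => ⟨hmem q, hopt q⟩, fun q q' hq => ?_⟩
  by_contra! hlt
  have hanti := hQ _ (hmem q') _ (hmem q) hlt.le hq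
  have h₁ := hopt q _ (hmem q')
  have h₂ : ¬ Q q' (π q') ≤ Q q' (π q) := fun h => absurd (htop q' _ (hmem q) h) (by
    simpa using hlt)
  simp only at hanti
  linarith

/-- threshold structure for `cog > cog*`, so `A(cog) = {S,R,N,H}`: under the
value-bound property, the sojourn-time ordering `t_s < E[τ|cog,R] < E[τ|cog,N] < E[τ|cog,H]`,
and the condition
`min{E[τ|cog,H]−E[τ|cog,N], E[τ|cog,N]−E[τ|cog,R], E[τ|cog,R]−t_s}
  + t_s·γ^{E[τ|cog,H]}/(1−γ^{t_max}) ≥ (t_max/(1−ρ))·max_{a ∈ A(cog)} E[γ^τ|cog,a]`,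
there exist thresholds `q₁* ≤ q₂* ≤ q₃*` in `ℤ ∪ {−∞,+∞}` and a selection
`π(q) ∈ argmax_{a ∈ A(cog)} Q_V(q,cog,a)` with `π = H` up to `q₁*`, `N` on `(q₁*,q₂*]`,
`R` on `(q₂*,q₃*]` and `S` above `q₃*`. -/
theorem stmt14 {C : Type*} [LinearOrder C] [Fintype C]
    (cogStar : C) (c lam rH rN γ : ℝ) (ts : ℕ)
    (Etau Etau2 : C → Action → ℝ) (P : C → Action → ℕ → C → ℝ)
    (hc : 0 < c) (hlam : 0 < lam) (hγ : γ ∈ Set.Ioo (0 : ℝ) 1)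
    (hrN : 0 ≤ rN) (hrHN : rN < rH) (hts : 1 ≤ ts)
    (hPnn : ∀ cog a τ cog', 0 ≤ P cog a τ cog')
    (hP0 : ∀ cog a cog', P cog a 0 cog' = 0)
    (hPsum : ∀ cog, ∀ a ∈ Act cogStar cog, (∑' (τ : ℕ), ∑' (cog' : C), P cog a τ cog') = 1)
    (hPS : ∀ cog τ cog', τ ≠ ts → P cog Action.S τ cog' = 0)
    (hEtau : ∀ cog a, Etau cog a = ∑' (τ : ℕ), ∑' (cog' : C), (τ : ℝ) * P cog a τ cog')
    (hEtau2 : ∀ cog a, Etau2 cog a = ∑' (τ : ℕ), ∑' (cog' : C), (τ : ℝ) ^ 2 * P cog a τ cog')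
    (hMom2 : ∀ cog a, Summable fun τ : ℕ => (τ : ℝ) ^ 2 * ∑' (cog' : C), P cog a τ cog')
    (tmax : ℕ) (htmax : 1 ≤ tmax) (ρ : ℝ) (hρ : ρ ∈ Set.Ioo (0 : ℝ) 1)
    (hEle : ∀ cog, ∀ a ∈ Act cogStar cog, Etau cog a ≤ (tmax : ℝ))
    (cog : C) (hcog : cogStar < cog)
    (V : ℤ → C → ℝ) (hV : ValueBound c γ ρ ts tmax V)
    (hord : (ts : ℝ) < Etau cog Action.R ∧ Etau cog Action.R < Etau cog Action.N ∧
      Etau cog Action.N < Etau cog Action.H)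
    (hcond : min (min (Etau cog Action.H - Etau cog Action.N)
            (Etau cog Action.N - Etau cog Action.R))
          (Etau cog Action.R - (ts : ℝ))
          + (ts : ℝ) * γ ^ Etau cog Action.H / (1 - γ ^ tmax)
        ≥ (tmax : ℝ) / (1 - ρ) *
          (Act cogStar cog).sup' (Act_nonempty cogStar cog) (fun a => Egamma γ P cog a)) :
    ∃ (q₁ q₂ q₃ : EReal) (π : ℤ → Action),
      q₁ ≤ q₂ ∧ q₂ ≤ q₃ ∧
      (∀ q : ℤ, π q ∈ Act cogStar cog ∧
        ∀ a ∈ Act cogStar cog, Qval c lam rH rN γ Etau Etau2 P V q cog a ≤ Qval c lam rH rN γ Etau Etau2 P V q cog (π q)) ∧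
      ∀ q : ℤ,
        (((q : ℝ) : EReal) ≤ q₁ → π q = Action.H) ∧
        (q₁ < ((q : ℝ) : EReal) ∧ ((q : ℝ) : EReal) ≤ q₂ → π q = Action.N) ∧
        (q₂ < ((q : ℝ) : EReal) ∧ ((q : ℝ) : EReal) ≤ q₃ → π q = Action.R) ∧
        (q₃ < ((q : ℝ) : EReal) → π q = Action.S) := by
  obtain ⟨hRS, hNR, hHN⟩ := hord
  have hAct : Act cogStar cog = {Action.S, Action.R, Action.N, Action.H} := if_neg hcog.not_ge
  have hall (a : Action) : a ∈ Act cogStar cog := by rw [hAct]; cases a <;> simp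
  have hγpow : 0 < 1 - γ ^ tmax :=
    sub_pos.2 (pow_lt_one₀ hγ.1.le hγ.2 (Nat.one_le_iff_ne_zero.1 htmax))
  have hρ' : 0 < 1 - ρ := sub_pos.2 hρ.2
  set L := c * (ts : ℝ) / (1 - γ ^ tmax) with hLdef
  set U := c * (tmax : ℝ) / (1 - ρ) with hUdef
  have hL : 0 ≤ L := by positivity
  have hU : 0 ≤ U := by positivity
  have hslope (x : C) : SlopeBound L U fun m => V m x := fun n k => by
    have h := hV x n k
    constructor
    · calc L * k = c * ts * k / (1 - γ ^ tmax) := by rw [hLdef]; ring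
        _ ≤ _ := h.1
    · calc _ ≤ c * tmax * k / (1 - ρ) := h.2
        _ = U * k := by rw [hUdef]; ring
  have hone (a : Action) : HasSum (fun τ => ∑ x, P cog a τ x) 1 := by
    have h := hPsum cog a (hall a)
    simp only [tsum_fintype] at h
    rw [← h]
    refine Summable.hasSum ?_
    by_contra hns
    rw [tsum_eq_zero_of_not_summable hns] at h
    exact zero_ne_one h
  have hmean (a : Action) : HasSum (fun τ : ℕ => ∑ x, (τ : ℝ) * P cog a τ x) (Etau cog a) := by
    rw [hEtau]
    simp only [tsum_fintype]
    refine Summable.hasSum ((hMom2 cog a).of_nonneg_of_le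
      (fun τ => Finset.sum_nonneg fun x _ => mul_nonneg τ.cast_nonneg (hPnn _ _ _ _))
      fun τ => ?_)
    rw [tsum_fintype, ← Finset.mul_sum]
    refine mul_le_mul_of_nonneg_right ?_ (Finset.sum_nonneg fun x _ => hPnn _ _ _ _)
    exact_mod_cast Nat.le_self_pow two_ne_zero τ
  have hEg (a : Action) : Egamma γ P cog a = ∑' τ : ℕ, ∑ x, γ ^ τ * P cog a τ x := by
    simp only [Egamma, tsum_fintype]
  set Q := fun q a => Qval c lam rH rN γ Etau Etau2 P V q cog a with hQdef
  have hdrop (a : Action) (q : ℤ) : Q q a - Q (q + 1) a ∈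
      Set.Icc (c * Etau cog a + L * Egamma γ P cog a)
        (c * Etau cog a + U * Egamma γ P cog a) := by
    have h := contValue_sub_mem hγ hlam.le hL (hPnn cog a) (hone a).summable
      (hmean a).summable hslope (nextQ a q 0)
    have hnext : nextQ a (q + 1) 0 = nextQ a q 0 + 1 := by unfold nextQ; split <;> ring
    rw [← hEg] at h
    simp only [hQdef, Qval_eq, Rimm, hnext]
    push_cast
    constructor
    · linarith [h.1]
    · linarith [h.2]
  have hjensen (a : Action) (ha : Etau cog a ≤ Etau cog Action.H) :
      γ ^ Etau cog Action.H ≤ Egamma γ P cog a := by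
    rw [hEg]
    exact (Real.rpow_le_rpow_of_exponent_ge hγ.1 hγ.2.le ha).trans
      (rpow_mean_le_discount hγ (hPnn cog a) (hone a) (hmean a))
  have hES : Etau cog Action.S = ts := by
    refine (hmean Action.S).unique ?_
    have h := (hone Action.S).mul_left (ts : ℝ)
    rw [mul_one] at h
    refine h.congr_fun fun τ => ?_
    rw [Finset.mul_sum]
    refine Finset.sum_congr rfl fun x _ => ?_
    by_cases hτ : τ = ts
    · rw [hτ]
    · rw [hPS cog τ x hτ, mul_zero, mul_zero]
  set δ := min (min (Etau cog Action.H - Etau cog Action.N)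
    (Etau cog Action.N - Etau cog Action.R)) (Etau cog Action.R - (ts : ℝ)) with hδ
  have hstep (a b : Action) (ha : Etau cog a ≤ Etau cog Action.H)
      (hab : δ ≤ Etau cog a - Etau cog b) : Antitone fun q => Q q a - Q q b := by
    refine antitone_int_of_succ_le fun q => ?_
    have h₁ := (hdrop a q).1
    have h₂ := (hdrop b q).2
    have h₃ := mul_le_mul_of_nonneg_left (hjensen a ha) hL
    have h₄ := mul_le_mul_of_nonneg_left
      (Finset.le_sup' (fun a => Egamma γ P cog a) (hall b)) hU
    have h₅ := mul_le_mul_of_nonneg_left hcond hc.le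
    have h₆ := mul_le_mul_of_nonneg_left hab hc.le
    have h₇ : c * (δ + ts * γ ^ Etau cog Action.H / (1 - γ ^ tmax)) =
        c * δ + L * γ ^ Etau cog Action.H := by rw [hLdef]; ring
    have h₈ : ∀ M : ℝ, c * ((tmax : ℝ) / (1 - ρ) * M) = U * M := fun M => by rw [hUdef]; ring
    rw [h₇, h₈] at h₅
    linarith
  have hHNs := hstep Action.H Action.N le_rfl ((min_le_left _ _).trans (min_le_left _ _))
  have hNRs := hstep Action.N Action.R hHN.le ((min_le_left _ _).trans (min_le_right _ _))
  have hRSs := hstep Action.R Action.S (hNR.trans hHN).le (by rw [hES]; exact min_le_right _ _)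
  obtain ⟨π, hπ, hmono⟩ := exists_monotone_argmax (Act cogStar cog) (Act_nonempty _ _) Q (by
    intro a _ b _ hab q q' hq
    have h₁ := hHNs hq
    have h₂ := hNRs hq
    have h₃ := hRSs hq
    simp only at h₁ h₂ h₃ ⊢
    cases a <;> cases b <;> simp only [Action.rank] at hab <;> first | omega | linarith)
  refine ⟨threshold (fun q => (π q).rank) 0, threshold (fun q => (π q).rank) 1,
    threshold (fun q => (π q).rank) 2, π, threshold_mono _ zero_le_one,
    threshold_mono _ one_le_two, hπ, fun q => ?_⟩
  simp only [← not_le, le_threshold_iff hmono]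
  cases π q <;> simp [Action.rank]

end Fidelity
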